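/- arXiv:0906.2631 — 4 statements merged into one kernel-verified Lean document; each statement's English description precedes it below -/
import Mathlib

section
/- Let T be a densely defined operator with compact resolvent on a complex Hilbert space H, and let M be the subspace of all finite linear combinations of root vectors of T. Then the restriction of the adjoint T* to the orthogonal complement M^⊥ (with domain M^⊥ ∩ D(T*)) has resolvent set equal to all of ℂ; that is, for every z ∈ ℂ the operator T*|_{M^⊥} − z maps M^⊥ ∩ D(T*) bijectively onto M^⊥ with bounded inverse. -/
open scoped InnerProductSpace ComplexInnerProductSpace
open Filter Metric Complex

noncomputable section

structure Op (H : Type*) [NormedAddCommGroup H] [InnerProductSpace ℂ H] : Type _ where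
  dom : Submodule ℂ H
  app : H →ₗ[ℂ] H

namespace Op

variable {H : Type*} [NormedAddCommGroup H] [InnerProductSpace ℂ H]

/-- `R` is the (bounded, everywhere defined) inverse of `T - z`. -/
def IsResolventAt (T : Op H) (z : ℂ) (R : H →L[ℂ] H) : Prop :=
  (∀ x, R x ∈ T.dom) ∧ (∀ x, T.app (R x) - z • R x = x) ∧
    ∀ x ∈ T.dom, R (T.app x - z • x) = x

def resolventSet (T : Op H) : Set ℂ := {z | ∃ R, T.IsResolventAt z R}

def spec (T : Op H) : Set ℂ := (T.resolventSet)ᶜ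

def HasCompactResolvent (T : Op H) : Prop :=
  ∃ z R, T.IsResolventAt z R ∧ IsCompactOperator R

def shift (T : Op H) (lam : ℂ) : H →ₗ[ℂ] H := T.app - lam • LinearMap.id

def IsRootVector (T : Op H) (lam : ℂ) (x : H) : Prop :=
  x ≠ 0 ∧ ∃ k : ℕ, 0 < k ∧ (∀ j < k, ((T.shift lam) ^ j) x ∈ T.dom) ∧
    ((T.shift lam) ^ k) x = 0

def rootSubspace (T : Op H) (lam : ℂ) : Submodule ℂ H :=
  Submodule.span ℂ {x | T.IsRootVector lam x}

def IsEigenvalue (T : Op H) (lam : ℂ) : Prop :=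
  ∃ x, x ≠ 0 ∧ x ∈ T.dom ∧ T.app x = lam • x

def rootSystem (T : Op H) : Submodule ℂ H :=
  Submodule.span ℂ {x | ∃ lam, T.IsRootVector lam x}

def CompleteRootSystem (T : Op H) : Prop := Dense (T.rootSystem : Set H)

def IsAdjointOf (T Tstar : Op H) : Prop :=
  (Tstar.dom : Set H) = {y | ∃ w, ∀ x ∈ T.dom, ⟪T.app x, y⟫_ℂ = ⟪x, w⟫_ℂ} ∧
    ∀ y ∈ Tstar.dom, ∀ x ∈ T.dom, ⟪T.app x, y⟫_ℂ = ⟪x, Tstar.app y⟫_ℂ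

def IsClosedOp (T : Op H) : Prop :=
  IsClosed {p : H × H | p.1 ∈ T.dom ∧ p.2 = T.app p.1}

def IsNormalOp (T : Op H) : Prop :=
  Dense (T.dom : Set H) ∧ T.IsClosedOp ∧
    ∃ Tstar : Op H, T.IsAdjointOf Tstar ∧ T.dom = Tstar.dom ∧
      ∀ u ∈ T.dom, ‖T.app u‖ = ‖Tstar.app u‖

/-- `S` is `p`-subordinate to `G` with bound `b`. -/
def Subordinate (S G : Op H) (p b : ℝ) : Prop :=
  (G.dom : Set H) ⊆ (S.dom : Set H) ∧
    ∀ u ∈ G.dom, ‖S.app u‖ ≤ b * ‖u‖ ^ (1 - p) * ‖G.app u‖ ^ p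

def addOp (G S : Op H) : Op H := ⟨G.dom, G.app + S.app⟩

/-- The sum of the root subspaces for eigenvalues in `K`. -/
def specSubspace (T : Op H) (K : Set ℂ) : Submodule ℂ H :=
  ⨆ lam ∈ K, T.rootSubspace lam

/-- `N(K,T)`: total multiplicity of the eigenvalues in `K`. -/
def dimIn (T : Op H) (K : Set ℂ) : ℕ :=
  Module.finrank ℂ (T.specSubspace K)

/-- `N_+(r₁,r₂,G)`. -/
def dimPlus (T : Op H) (r1 r2 : ℝ) : ℕ :=
  T.dimIn {z | z.im = 0 ∧ r1 < z.re ∧ z.re < r2}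

end Op

def IsRieszBasisOfSubspacesWith {H : Type*} [NormedAddCommGroup H]
    [InnerProductSpace ℂ H] {Λ : Type*} (V : Λ → Submodule ℂ H) (c : ℝ) : Prop :=
  Dense (↑(⨆ k, V k) : Set H) ∧
    ∀ (F : Finset Λ) (x : Λ → H), (∀ k ∈ F, x k ∈ V k) →
      c⁻¹ * ∑ k ∈ F, ‖x k‖ ^ 2 ≤ ‖∑ k ∈ F, x k‖ ^ 2 ∧
        ‖∑ k ∈ F, x k‖ ^ 2 ≤ c * ∑ k ∈ F, ‖x k‖ ^ 2

def IsRieszBasisOfSubspaces {H : Type*} [NormedAddCommGroup H]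
    [InnerProductSpace ℂ H] {Λ : Type*} (V : Λ → Submodule ℂ H) : Prop :=
  ∃ c : ℝ, 1 ≤ c ∧ IsRieszBasisOfSubspacesWith V c

end
namespace ContinuousLinearMap

variable {H : Type*} [NormedAddCommGroup H] [InnerProductSpace ℂ H] [CompleteSpace H]

/-- The kernels of the powers of `R - ν` stabilise when `R` is compact and `ν ≠ 0`. -/
theorem exists_ker_pow_stable {R : H →L[ℂ] H} (hR : IsCompactOperator R) {ν : ℂ} (hν : ν ≠ 0) :
    ∃ n : ℕ, ∀ x, ((R - ν • 1) ^ (n + 1)) x = 0 → ((R - ν • 1) ^ n) x = 0 := by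
  set S : H →L[ℂ] H := R - ν • 1 with hS
  by_contra! hcon
  have hmono : ∀ {m n : ℕ} {x : H}, m ≤ n → (S ^ m) x = 0 → (S ^ n) x = 0 := by
    intro m n x hmn hx
    obtain ⟨d, rfl⟩ := Nat.exists_eq_add_of_le' hmn
    rw [pow_add, mul_apply_eq_comp, hx, map_zero]
  have hunit : ∀ n : ℕ, ∃ e : H, ‖e‖ = 1 ∧ (S ^ (n + 1)) e = 0 ∧
      ∀ v, (S ^ n) v = 0 → ⟪e, v⟫_ℂ = 0 := by
    intro n
    obtain ⟨x, hx, hx'⟩ := hcon n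
    let V : Submodule ℂ H := LinearMap.ker (S ^ n : H →L[ℂ] H).toLinearMap
    have hV : IsClosed (V : Set H) := ContinuousLinearMap.isClosed_ker (S ^ n)
    have : CompleteSpace V := hV.completeSpace_coe
    have hp : (S ^ n) (V.starProjection x) = 0 := V.starProjection_apply_mem x
    set y := x - V.starProjection x with hy
    have hy0 : y ≠ 0 := by
      intro h
      rw [sub_eq_zero.mp h] at hx'
      exact hx' hp
    refine ⟨((‖y‖⁻¹ : ℝ) : ℂ) • y, ?_, ?_, ?_⟩
    · rw [norm_smul, Complex.norm_real, norm_inv, norm_norm, inv_mul_cancel₀ (norm_ne_zero_iff.mpr hy0)]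
    · rw [map_smul, hy, map_sub, hx, hmono n.le_succ hp, sub_zero, smul_zero]
    · intro v hv
      have h : y ∈ Vᗮ := V.sub_starProjection_mem_orthogonal x
      rw [inner_smul_left, (Submodule.mem_orthogonal' V y).mp h v hv, mul_zero]
  choose e he1 heS heo using hunit
  have hRS : ∀ x, R x = S x + ν • x := fun x => by simp [hS]
  have hsep : ∀ m n, m < n → ‖ν‖ ≤ ‖R (e n) - R (e m)‖ := by
    intro m n hmn
    have h1 : ⟪e n, S (e n)⟫_ℂ = 0 := heo n _ (by rw [← mul_apply_eq_comp, ← pow_succ]; exact heS n)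
    have h2 : ⟪e n, S (e m)⟫_ℂ = 0 :=
      heo n _ (hmono hmn.le (by rw [← mul_apply_eq_comp, ← pow_succ]; exact heS m))
    have h3 : ⟪e n, e m⟫_ℂ = 0 := heo n _ (hmono hmn (heS m))
    have h4 : ⟪e n, R (e n) - R (e m)⟫_ℂ = ν := by
      rw [hRS, hRS, inner_sub_right, inner_add_right, inner_add_right, inner_smul_right,
        inner_smul_right, h1, h2, h3, inner_self_eq_norm_sq_to_K, he1]
      simp
    calc ‖ν‖ = ‖⟪e n, R (e n) - R (e m)⟫_ℂ‖ := by rw [h4]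
      _ ≤ ‖e n‖ * ‖R (e n) - R (e m)‖ := norm_inner_le_norm _ _
      _ = _ := by rw [he1, one_mul]
  have hcpt := hR.isCompact_closure_image_closedBall 1
  obtain ⟨a, -, φ, hφ, hlim⟩ := hcpt.tendsto_subseq (x := fun n => R (e n))
    (fun n => subset_closure ⟨e n, by simp [he1], rfl⟩)
  obtain ⟨N, hN⟩ := Metric.cauchySeq_iff'.mp hlim.cauchySeq ‖ν‖ (norm_pos_iff.mpr hν)
  have := hN (N + 1) N.le_succ
  rw [dist_eq_norm] at this
  exact (this.trans_le (hsep _ _ (hφ N.lt_succ_self))).false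

/-- The compression of `R` to the orthogonal complement of `V`. -/
noncomputable def compressOrthogonal (R : H →L[ℂ] H) (V : Submodule ℂ H) : Vᗮ →L[ℂ] Vᗮ :=
  Vᗮ.orthogonalProjectionOnto ∘L R ∘L Vᗮ.subtypeL

theorem isCompactOperator_compressOrthogonal {R : H →L[ℂ] H} (hR : IsCompactOperator R)
    (V : Submodule ℂ H) : IsCompactOperator (R.compressOrthogonal V) :=
  (hR.comp_clm Vᗮ.subtypeL).clm_comp Vᗮ.orthogonalProjectionOnto

theorem compressOrthogonal_sub_apply (R : H →L[ℂ] H) (V : Submodule ℂ H) (ν : ℂ) (x : Vᗮ) :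
    (R.compressOrthogonal V - ν • 1) x = Vᗮ.orthogonalProjectionOnto ((R - ν • 1) (x : H)) := by
  simp [compressOrthogonal]

theorem isUnit_sub_of_ker_eq_zero {R : H →L[ℂ] H} (hR : IsCompactOperator R) {ν : ℂ}
    (hν : ν ≠ 0) (hinj : ∀ x, (R - ν • 1) x = 0 → x = 0) : IsUnit (R - ν • 1) := by
  rcases hR.hasEigenvalue_or_mem_resolventSet hν with h | h
  · obtain ⟨x, hx⟩ := h.exists_hasEigenvector
    refine absurd (hinj x ?_) hx.2
    have := hx.apply_eq_smul
    simpa [sub_eq_zero] using! this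
  · rw [spectrum.mem_resolventSet_iff, Algebra.algebraMap_eq_smul_one] at h
    simpa using h.neg

theorem exists_ker_pow_add_range {R : H →L[ℂ] H} (hR : IsCompactOperator R) {ν : ℂ}
    (hν : ν ≠ 0) :
    ∃ n : ℕ, ∀ h : H, ∃ x, ((R - ν • 1) ^ n) (h - (R - ν • 1) x) = 0 := by
  obtain ⟨n, hn⟩ := exists_ker_pow_stable hR hν
  refine ⟨n, fun h => ?_⟩
  let V : Submodule ℂ H := LinearMap.ker ((R - ν • 1) ^ n : H →L[ℂ] H).toLinearMap
  have hV : IsClosed (V : Set H) := ContinuousLinearMap.isClosed_ker ((R - ν • 1) ^ n)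
  have : CompleteSpace V := hV.completeSpace_coe
  have hproj : ∀ y : H, Vᗮ.orthogonalProjectionOnto y = 0 → y ∈ V := by
    intro y hy
    rw [Submodule.orthogonalProjectionOnto_eq_zero_iff, Submodule.orthogonal_orthogonal] at hy
    exact hy
  have hu : IsUnit (R.compressOrthogonal V - ν • 1) := by
    refine isUnit_sub_of_ker_eq_zero (isCompactOperator_compressOrthogonal hR V) hν ?_
    intro x hx
    rw [compressOrthogonal_sub_apply] at hx
    have h1 : ((R - ν • 1) ^ n) ((R - ν • 1) (x : H)) = 0 := hproj _ hx
    rw [← mul_apply_eq_comp, ← pow_succ] at h1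
    have h2 : (x : H) ∈ V := hn _ h1
    exact Subtype.ext (inner_self_eq_zero.mp ((Submodule.mem_orthogonal V _).mp x.2 _ h2))
  obtain ⟨x, hx⟩ := ((isUnit_iff_bijective.mp hu).2) (Vᗮ.orthogonalProjectionOnto h)
  rw [compressOrthogonal_sub_apply] at hx
  exact ⟨x, hproj _ (by rw [map_sub, hx, sub_self])⟩

theorem isUnit_sub_of_surjective {R : H →L[ℂ] H} (hR : IsCompactOperator R) {ν : ℂ}
    (hν : ν ≠ 0) (hsurj : Function.Surjective (R - ν • 1 : H →L[ℂ] H)) : IsUnit (R - ν • 1) := by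
  refine isUnit_sub_of_ker_eq_zero hR hν fun x hx => ?_
  obtain ⟨n, hn⟩ := exists_ker_pow_stable hR hν
  obtain ⟨y, rfl⟩ : ∃ y, ((R - ν • 1) ^ n) y = x := by
    obtain ⟨y, hy⟩ := hsurj.iterate n x
    exact ⟨y, by rw [← hy, pow_apply_eq_iterate]⟩
  apply hn
  rwa [pow_succ', mul_apply_eq_comp]

/-- If `V` is invariant under the compact operator `R` and contains all root vectors of `R` for
nonzero eigenvalues, then the adjoint of the compression of `R` to `Vᗮ` is quasinilpotent. -/
theorem isUnit_one_sub_adjoint_compressOrthogonal {R : H →L[ℂ] H} (hR : IsCompactOperator R)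
    {V : Submodule ℂ H} (hinv : ∀ x ∈ V, R x ∈ V)
    (hroot : ∀ ν : ℂ, ν ≠ 0 → ∀ (n : ℕ) (x : H), ((R - ν • 1) ^ n) x = 0 → x ∈ V) (w : ℂ) :
    IsUnit (1 - w • adjoint (R.compressOrthogonal V)) := by
  by_cases hw : w = 0
  · simp [hw]
  set ν : ℂ := (starRingEnd ℂ w)⁻¹ with hνdef
  have hν : ν ≠ 0 := inv_ne_zero ((map_ne_zero _).mpr hw)
  have hVclos : ∀ x ∈ Vᗮᗮ, (R - ν • 1) x ∈ Vᗮᗮ := by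
    rw [Submodule.orthogonal_orthogonal_eq_closure]
    intro x hx
    refine map_mem_closure (R - ν • 1).continuous hx fun y hy => ?_
    simpa using! V.sub_mem (hinv y hy) (V.smul_mem ν hy)
  have hu : IsUnit (R.compressOrthogonal V - ν • 1) := by
    refine isUnit_sub_of_surjective (isCompactOperator_compressOrthogonal hR V) hν fun h => ?_
    obtain ⟨n, hn⟩ := exists_ker_pow_add_range hR hν
    obtain ⟨x, hx⟩ := hn h
    refine ⟨Vᗮ.orthogonalProjectionOnto x, ?_⟩
    have h1 : Vᗮ.orthogonalProjectionOnto ((h : H) - (R - ν • 1) x) = 0 := by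
      rw [Submodule.orthogonalProjectionOnto_eq_zero_iff]
      exact V.le_orthogonal_orthogonal (hroot ν hν n _ hx)
    have h2 : Vᗮ.orthogonalProjectionOnto
        ((R - ν • 1) (x - (Vᗮ.orthogonalProjectionOnto x : H))) = 0 := by
      rw [Submodule.orthogonalProjectionOnto_eq_zero_iff]
      exact hVclos _ (Submodule.sub_starProjection_mem_orthogonal x)
    rw [map_sub, Submodule.orthogonalProjectionOnto_mem_subspace_eq_self, sub_eq_zero] at h1
    rw [map_sub, map_sub, sub_eq_zero] at h2
    rw [compressOrthogonal_sub_apply, ← h2, ← h1]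
  have hadj : IsUnit (adjoint (R.compressOrthogonal V - ν • 1)) := by
    rw [← star_eq_adjoint]; exact hu.star
  have key : (1 - w • adjoint (R.compressOrthogonal V)) =
      (-w) • adjoint (R.compressOrthogonal V - ν • 1) := by
    have : star ν = w⁻¹ := by simp [hνdef]
    rw [← star_eq_adjoint, ← star_eq_adjoint, star_sub, star_smul, star_one, this, smul_sub,
      smul_smul, neg_mul, mul_inv_cancel₀ hw]
    simp [neg_smul]
    abel
  rw [key]
  exact hadj.smul (Units.mk0 (-w) (neg_ne_zero.mpr hw))

theorem coe_adjoint_compressOrthogonal_apply {R : H →L[ℂ] H} {V : Submodule ℂ H}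
    (hinv : ∀ x ∈ V, R x ∈ V) (y : Vᗮ) :
    (adjoint (R.compressOrthogonal V) y : H) = adjoint R y := by
  have hmem : adjoint R (y : H) ∈ Vᗮ := by
    rw [Submodule.mem_orthogonal]
    intro u hu
    rw [adjoint_inner_right]
    exact (Submodule.mem_orthogonal V _).mp y.2 _ (hinv u hu)
  rw [compressOrthogonal, adjoint_comp, adjoint_comp, Submodule.adjoint_subtypeL,
    Submodule.adjoint_orthogonalProjectionOnto]
  exact Submodule.starProjection_eq_self_iff.mpr hmem

end ContinuousLinearMap

namespace Op

variable {H : Type*} [NormedAddCommGroup H] [InnerProductSpace ℂ H]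

/-- The vectors annihilated by `(T - lam) ^ k`, with all intermediate vectors in the domain. -/
def kerPow (T : Op H) (lam : ℂ) (k : ℕ) : Submodule ℂ H where
  carrier := {x | (∀ j < k, ((T.shift lam) ^ j) x ∈ T.dom) ∧ ((T.shift lam) ^ k) x = 0}
  zero_mem' := by simp
  add_mem' := by
    rintro x y ⟨hx, hx'⟩ ⟨hy, hy'⟩
    refine ⟨fun j hj => ?_, by rw [map_add, hx', hy', add_zero]⟩
    rw [map_add]
    exact T.dom.add_mem (hx j hj) (hy j hj)
  smul_mem' := by
    rintro c x ⟨hx, hx'⟩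
    refine ⟨fun j hj => ?_, by rw [map_smul, hx', smul_zero]⟩
    rw [map_smul]
    exact T.dom.smul_mem c (hx j hj)

theorem mem_kerPow_zero {T : Op H} {lam : ℂ} {x : H} : x ∈ T.kerPow lam 0 ↔ x = 0 := by
  simp [kerPow]

theorem mem_kerPow_succ {T : Op H} {lam : ℂ} {k : ℕ} {x : H} :
    x ∈ T.kerPow lam (k + 1) ↔ x ∈ T.dom ∧ T.shift lam x ∈ T.kerPow lam k := by
  constructor
  · rintro ⟨h, h'⟩
    refine ⟨by simpa using h 0 k.succ_pos, fun j hj => ?_, ?_⟩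
    · simpa [pow_succ] using h (j + 1) (Nat.succ_lt_succ hj)
    · simpa [pow_succ] using h'
  · rintro ⟨h0, h, h'⟩
    refine ⟨fun j hj => ?_, by simpa [pow_succ] using h'⟩
    cases j with
    | zero => simpa using h0
    | succ j => simpa [pow_succ] using h j (Nat.lt_of_succ_lt_succ hj)

theorem kerPow_le_succ (T : Op H) (lam : ℂ) (k : ℕ) : T.kerPow lam k ≤ T.kerPow lam (k + 1) := by
  induction k with
  | zero =>
    intro x hx
    rw [mem_kerPow_zero.mp hx]
    exact zero_mem _
  | succ k ih =>
    intro x hx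
    obtain ⟨h, h'⟩ := mem_kerPow_succ.mp hx
    exact mem_kerPow_succ.mpr ⟨h, ih h'⟩

theorem mem_dom_of_mem_kerPow {T : Op H} {lam : ℂ} {k : ℕ} {x : H} (hx : x ∈ T.kerPow lam k) :
    x ∈ T.dom :=
  (mem_kerPow_succ.mp (T.kerPow_le_succ lam k hx)).1

theorem app_sub_smul_mem_kerPow {T : Op H} {lam : ℂ} {k : ℕ} {x : H}
    (hx : x ∈ T.kerPow lam k) (z : ℂ) : T.app x - z • x ∈ T.kerPow lam k := by
  have h1 := (mem_kerPow_succ.mp (T.kerPow_le_succ lam k hx)).2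
  have h2 : T.app x - z • x = T.shift lam x + (lam - z) • x := by
    simp [shift, sub_smul]
  rw [h2]
  exact add_mem h1 (Submodule.smul_mem _ _ hx)

theorem kerPow_le_rootSystem (T : Op H) (lam : ℂ) (k : ℕ) : T.kerPow lam k ≤ T.rootSystem := by
  intro x hx
  by_cases h0 : x = 0
  · rw [h0]
    exact zero_mem _
  · exact Submodule.subset_span ⟨lam, h0, k + 1, k.succ_pos, T.kerPow_le_succ lam k hx⟩

theorem rootSystem_induction {T : Op H} {p : H → Prop}
    (hker : ∀ lam k, ∀ x ∈ T.kerPow lam k, p x) (hadd : ∀ x y, p x → p y → p (x + y))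
    (hsmul : ∀ (c : ℂ) x, p x → p (c • x)) {x : H} (hx : x ∈ T.rootSystem) : p x := by
  refine Submodule.span_induction (p := fun x _ => p x) ?_ (hker 0 0 0 (zero_mem _))
    (fun x y _ _ => hadd x y) (fun c x _ => hsmul c x) hx
  rintro x ⟨lam, -, k, -, h⟩
  exact hker lam k x h

theorem mem_dom_of_mem_rootSystem {T : Op H} {x : H} (hx : x ∈ T.rootSystem) : x ∈ T.dom :=
  rootSystem_induction (p := (· ∈ T.dom)) (fun _ _ _ => mem_dom_of_mem_kerPow)
    (fun _ _ => add_mem) (fun c _ => T.dom.smul_mem c) hx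

theorem app_sub_smul_mem_rootSystem {T : Op H} (z : ℂ) {x : H} (hx : x ∈ T.rootSystem) :
    T.app x - z • x ∈ T.rootSystem := by
  refine rootSystem_induction (p := fun x => T.app x - z • x ∈ T.rootSystem)
    (fun lam k x h => T.kerPow_le_rootSystem lam k (app_sub_smul_mem_kerPow h z)) ?_ ?_ hx
  · intro x y hx hy
    have : T.app (x + y) - z • (x + y) = (T.app x - z • x) + (T.app y - z • y) := by
      rw [map_add, smul_add]; abel
    rw [this]
    exact add_mem hx hy
  · intro c x hx
    have : T.app (c • x) - z • (c • x) = c • (T.app x - z • x) := by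
      rw [map_smul, smul_sub, smul_comm]
    rw [this]
    exact Submodule.smul_mem _ _ hx

namespace IsResolventAt

variable {T : Op H} {z : ℂ} {R : H →L[ℂ] H}

theorem map_mem_kerPow (hR : T.IsResolventAt z R) {lam : ℂ} {k : ℕ} {x : H}
    (hx : x ∈ T.kerPow lam k) : R x ∈ T.kerPow lam k := by
  induction k generalizing x with
  | zero =>
    rw [mem_kerPow_zero.mp hx, map_zero]
    exact zero_mem _
  | succ k ih =>
    obtain ⟨h, h'⟩ := mem_kerPow_succ.mp hx
    refine mem_kerPow_succ.mpr ⟨hR.1 x, ?_⟩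
    have key : T.shift lam (R x) = R (T.shift lam x) := by
      have h1 : T.shift lam (R x) = (T.app (R x) - z • R x) + (z - lam) • R x := by
        simp [shift, sub_smul]
      have h2 : T.shift lam x = (T.app x - z • x) + (z - lam) • x := by
        simp [shift, sub_smul]
      rw [h1, h2, hR.2.1, map_add, hR.2.2 x h, map_smul]
    rw [key]
    exact ih h'

theorem map_mem_rootSystem (hR : T.IsResolventAt z R) {x : H} (hx : x ∈ T.rootSystem) :
    R x ∈ T.rootSystem := by
  refine rootSystem_induction (p := fun x => R x ∈ T.rootSystem)
    (fun lam k x h => T.kerPow_le_rootSystem lam k (hR.map_mem_kerPow h)) ?_ ?_ hx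
  · intro x y hx hy
    rw [map_add]
    exact add_mem hx hy
  · intro c x hx
    rw [map_smul]
    exact Submodule.smul_mem _ _ hx

theorem mem_kerPow_of_pow_apply_eq_zero (hR : T.IsResolventAt z R) {ν : ℂ} (hν : ν ≠ 0) {k : ℕ}
    {x : H} (hx : ((R - ν • 1) ^ k) x = 0) : x ∈ T.kerPow (z + ν⁻¹) k := by
  induction k generalizing x with
  | zero => exact mem_kerPow_zero.mpr (by simpa using hx)
  | succ k ih =>
    rw [pow_succ, mul_apply_eq_comp] at hx
    have hy := ih hx
    set y := (R - ν • 1) x with hydef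
    have hxy : x = ν⁻¹ • (R x - y) := by
      have : R x - y = ν • x := by simp [hydef]
      rw [this, inv_smul_smul₀ hν]
    refine mem_kerPow_succ.mpr ⟨?_, ?_⟩
    · rw [hxy]
      exact T.dom.smul_mem _ (sub_mem (hR.1 x) (mem_dom_of_mem_kerPow hy))
    · have h1 : T.app x - z • x = ν⁻¹ • (x - (T.app y - z • y)) := by
        conv_lhs => rw [hxy]
        conv_rhs => enter [2, 1]; rw [← hR.2.1 x]
        rw [map_smul, map_sub]
        module
      have h2 : T.shift (z + ν⁻¹) x = (-ν⁻¹) • (T.app y - z • y) := by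
        have : T.shift (z + ν⁻¹) x = (T.app x - z • x) - ν⁻¹ • x := by
          simp only [shift, LinearMap.sub_apply, LinearMap.smul_apply, LinearMap.id_apply]
          module
        rw [this, h1]
        module
      rw [h2]
      exact Submodule.smul_mem _ _ (app_sub_smul_mem_kerPow hy z)

variable [CompleteSpace H] {Tstar : Op H}

open ContinuousLinearMap in
theorem isResolventAt_adjoint (hR : T.IsResolventAt z R) (hdense : Dense (T.dom : Set H))
    (hadj : T.IsAdjointOf Tstar) :
    Tstar.IsResolventAt (starRingEnd ℂ z) (adjoint R) := by
  have hform : ∀ u, ∀ x ∈ T.dom, ⟪T.app x, adjoint R u⟫_ℂ =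
      ⟪x, u + starRingEnd ℂ z • adjoint R u⟫_ℂ := by
    intro u x hx
    have h1 : T.app x = (T.app x - z • x) + z • x := by abel
    rw [h1, inner_add_left, adjoint_inner_right, hR.2.2 x hx, inner_add_right, inner_smul_left,
      inner_smul_right]
  have hmem : ∀ u, adjoint R u ∈ Tstar.dom := by
    intro u
    rw [← SetLike.mem_coe, hadj.1]
    exact ⟨_, hform u⟩
  refine ⟨hmem, fun u => ?_, fun y hy => ?_⟩
  · rw [sub_eq_iff_eq_add]
    refine hdense.eq_of_inner_right ℂ fun x hx => ?_
    rw [← hadj.2 _ (hmem u) x hx, hform u x hx]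
  · refine ext_inner_left ℂ fun h => ?_
    rw [adjoint_inner_right, inner_sub_right, ← hadj.2 y hy _ (hR.1 h), inner_smul_right,
      ← inner_smul_left, ← inner_sub_left, hR.2.1]

end IsResolventAt

end Op

/-- For a densely defined operator `T` with compact resolvent on a complex
Hilbert space, the restriction of `T*` to the orthogonal complement `Mᗮ` of the span `M`
of the root vectors of `T` has resolvent set all of `ℂ`: for every `z ∈ ℂ`, `T*|_{Mᗮ} - z`
maps `Mᗮ ∩ D(T*)` bijectively onto `Mᗮ` with bounded inverse. -/
theorem statement0 {H : Type*} [NormedAddCommGroup H] [InnerProductSpace ℂ H]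
    [CompleteSpace H] (T Tstar : Op H)
    (hdense : Dense (T.dom : Set H))
    (hcompact : T.HasCompactResolvent)
    (hadj : T.IsAdjointOf Tstar) (z : ℂ) :
    Set.BijOn (fun x => Tstar.app x - z • x)
      ((T.rootSystemᗮ : Set H) ∩ (Tstar.dom : Set H)) (T.rootSystemᗮ : Set H) ∧
    ∃ C : ℝ, 0 ≤ C ∧ ∀ x ∈ (T.rootSystemᗮ : Set H) ∩ (Tstar.dom : Set H),
      ‖x‖ ≤ C * ‖Tstar.app x - z • x‖ := by
  obtain ⟨z₀, R, hR, hRc⟩ := hcompact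
  set M := T.rootSystem
  have hR' := hR.isResolventAt_adjoint hdense hadj
  have hinv : ∀ x ∈ M, R x ∈ M := fun x => hR.map_mem_rootSystem
  obtain ⟨U, hU⟩ := ContinuousLinearMap.isUnit_one_sub_adjoint_compressOrthogonal hRc hinv
    (fun ν hν n x hx => T.kerPow_le_rootSystem _ n (hR.mem_kerPow_of_pow_apply_eq_zero hν hx))
    (z - starRingEnd ℂ z₀)
  set R' := ContinuousLinearMap.adjoint R
  have hUapp : ∀ u : Mᗮ, ((U : Mᗮ →L[ℂ] Mᗮ) u : H) = Tstar.app (R' u) - z • R' u := by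
    intro u
    have h1 : Tstar.app (R' u) = u + starRingEnd ℂ z₀ • R' u := by
      rw [← sub_eq_iff_eq_add]
      exact hR'.2.1 u
    rw [hU, h1]
    simp only [sub_apply, one_apply_eq_self, smul_apply,
      Submodule.coe_sub, Submodule.coe_smul,
      ContinuousLinearMap.coe_adjoint_compressOrthogonal_apply hinv]
    module
  have hR'mem : ∀ u : Mᗮ, R' u ∈ Mᗮ := fun u => by
    rw [← ContinuousLinearMap.coe_adjoint_compressOrthogonal_apply hinv]
    exact Submodule.coe_mem _
  have hpre : ∀ x ∈ (Mᗮ : Set H) ∩ (Tstar.dom : Set H), ∃ u : Mᗮ, R' u = x := by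
    rintro x ⟨hxM, hxd⟩
    refine ⟨⟨Tstar.app x - starRingEnd ℂ z₀ • x, ?_⟩, hR'.2.2 x hxd⟩
    rw [Submodule.mem_orthogonal]
    intro m hm
    rw [inner_sub_right, ← hadj.2 x hxd m (Op.mem_dom_of_mem_rootSystem hm), inner_smul_right,
      ← inner_smul_left, ← inner_sub_left]
    exact (Submodule.mem_orthogonal M x).mp hxM _ (Op.app_sub_smul_mem_rootSystem z₀ hm)
  have hinvU : ∀ u, (↑U⁻¹ : Mᗮ →L[ℂ] Mᗮ) ((U : Mᗮ →L[ℂ] Mᗮ) u) = u := fun u => by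
    rw [← mul_apply_eq_comp, U.inv_mul, one_apply_eq_self]
  have hUinv : ∀ u, (U : Mᗮ →L[ℂ] Mᗮ) ((↑U⁻¹ : Mᗮ →L[ℂ] Mᗮ) u) = u := fun u => by
    rw [← mul_apply_eq_comp, U.mul_inv, one_apply_eq_self]
  refine ⟨⟨?_, ?_, ?_⟩, ‖R'‖ * ‖(↑U⁻¹ : Mᗮ →L[ℂ] Mᗮ)‖, by positivity, ?_⟩
  · intro x hx
    obtain ⟨u, rfl⟩ := hpre x hx
    simp only [← hUapp]
    exact Submodule.coe_mem _
  · intro x hx y hy hxy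
    obtain ⟨u, rfl⟩ := hpre x hx
    obtain ⟨v, rfl⟩ := hpre y hy
    simp only [← hUapp] at hxy
    rw [← hinvU u, Subtype.ext hxy, hinvU v]
  · intro v hv
    refine ⟨R' ((↑U⁻¹ : Mᗮ →L[ℂ] Mᗮ) ⟨v, hv⟩), ⟨hR'mem _, hR'.1 _⟩, ?_⟩
    simp only [← hUapp, hUinv]
  · intro x hx
    obtain ⟨u, rfl⟩ := hpre x hx
    rw [← hUapp, mul_assoc]
    refine (R'.le_opNorm _).trans (mul_le_mul_of_nonneg_left ?_ (norm_nonneg _))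
    calc ‖(u : H)‖ = ‖(↑U⁻¹ : Mᗮ →L[ℂ] Mᗮ) ((U : Mᗮ →L[ℂ] Mᗮ) u)‖ := by rw [hinvU]; rfl
      _ ≤ _ := ContinuousLinearMap.le_opNorm _ _
end

section
/- Let T be a densely defined operator with compact resolvent on a complex Hilbert space H. Suppose there exists a sequence of bounded open regions (U_k)_{k∈ℕ} in ℂ such that ℂ = ⋃_{k∈ℕ} U_k, the boundary ∂U_k is contained in ρ(T) for every k, and there is a constant C ≥ 0 with ‖(T−z)^{-1}‖ ≤ C for all z ∈ ∂U_k and all k ∈ ℕ. Then the system of root subspaces of T is complete, i.e., the set of finite linear combinations of root vectors of T is dense in H. -/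
open scoped InnerProductSpace ComplexInnerProductSpace
open Filter Metric Complex

section CompactOperator

variable {H : Type*} [NormedAddCommGroup H] [InnerProductSpace ℂ H]

theorem exists_sub_smul_pow_eq_smul_one_add_compact {R : H →L[ℂ] H} (hR : IsCompactOperator R)
    (μ : ℂ) (n : ℕ) :
    ∃ K : H →L[ℂ] H, IsCompactOperator K ∧ (R - μ • 1) ^ n = (-μ) ^ n • 1 + K := by
  induction n with
  | zero => exact ⟨0, isCompactOperator_zero, by simp⟩
  | succ n ih =>
    obtain ⟨K, hK, h⟩ := ih
    refine ⟨(-μ) ^ n • R + K * (R - μ • 1), ?_, ?_⟩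
    · exact (hR.smul ((-μ) ^ n)).add (hK.comp_clm (R - μ • 1))
    · rw [pow_succ, h, add_mul, pow_succ]
      ext x
      simp
      module

variable [CompleteSpace H]

/-- A compact perturbation of a nonzero multiple of the identity that is injective maps every
invariant closed subspace onto itself. -/
theorem IsCompactOperator.exists_mem_smul_add_eq {L : H →L[ℂ] H} (hL : IsCompactOperator L)
    {c : ℂ} (hc : c ≠ 0) (hinj : ∀ x, c • x + L x = 0 → x = 0) {N : Submodule ℂ H}
    (hN : IsClosed (N : Set H)) (hLN : ∀ x ∈ N, L x ∈ N) {y : H} (hy : y ∈ N) :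
    ∃ x ∈ N, c • x + L x = y := by
  have : CompleteSpace N := hN.completeSpace_coe
  let S : N →L[ℂ] N := L.restrict hLN
  have hS : IsCompactOperator S := hL.restrict' hLN
  rcases hS.hasEigenvalue_or_mem_resolventSet (neg_ne_zero.mpr hc) with h | h
  · obtain ⟨v, hv⟩ := h.exists_hasEigenvector
    refine absurd (Subtype.ext (hinj v ?_)) hv.2
    have h1 : L v = -c • (v : H) := congrArg Subtype.val hv.apply_eq_smul
    rw [h1]
    module
  · rw [spectrum.mem_resolventSet_iff, ContinuousLinearMap.isUnit_iff_bijective] at h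
    obtain ⟨x, hx⟩ := h.2 (-⟨y, hy⟩)
    refine ⟨x, x.2, ?_⟩
    have h1 : -c • (x : H) - L x = -y := by
      have := congrArg Subtype.val hx
      simpa [S, Algebra.algebraMap_eq_smul_one] using this
    have h2 : c • (x : H) + L x = -(-c • (x : H) - L x) := by module
    rw [h2, h1, neg_neg]

/-- `R - μ` has finite ascent when `R` is compact and `μ ≠ 0`. -/
theorem IsCompactOperator.exists_ker_pow_succ_le {R : H →L[ℂ] H} (hR : IsCompactOperator R)
    {μ : ℂ} (hμ : μ ≠ 0) :
    ∃ n : ℕ, ∀ x, ((R - μ • 1) ^ (n + 1)) x = 0 → ((R - μ • 1) ^ n) x = 0 := by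
  by_contra! hcon
  set A := R - μ • 1 with hA
  let V : ℕ → Submodule ℂ H := fun n => (A ^ n).ker
  have hVmono : Monotone V := by
    refine monotone_nat_of_le_succ fun n x hx => ?_
    have hx' : (A ^ n) x = 0 := hx
    change (A ^ (n + 1)) x = 0
    rw [pow_succ', mul_apply_eq_comp, hx', map_zero]
  have hVclosed (n : ℕ) : IsClosed (V n : Set H) := (A ^ n).isClosed_ker
  have hAV (n : ℕ) {x : H} (hx : x ∈ V (n + 1)) : A x ∈ V n := by
    have hx' : (A ^ (n + 1)) x = 0 := hx
    rwa [pow_succ] at hx'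
  have hRV (n : ℕ) {x : H} (hx : x ∈ V (n + 1)) : R x ∈ V (n + 1) := by
    have : R x = A x + μ • x := by simp [hA]
    rw [this]
    exact add_mem (hVmono n.le_succ (hAV n hx)) (Submodule.smul_mem _ _ hx)
  have hex (n : ℕ) : ∃ e ∈ V (n + 1), ‖e‖ = 1 ∧ ∀ y ∈ V n, ⟪e, y⟫_ℂ = 0 := by
    obtain ⟨x, hx, hx'⟩ := hcon n
    have : CompleteSpace (V n) := (hVclosed n).completeSpace_coe
    set u := x - (V n).starProjection x with hu
    have hu0 : u ≠ 0 := by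
      intro h
      apply hx'
      have : x = (V n).starProjection x := sub_eq_zero.mp h
      have h2 : x ∈ V n := this ▸ (V n).starProjection_apply_mem x
      exact h2
    have huo : u ∈ (V n)ᗮ := (V n).sub_starProjection_mem_orthogonal x
    have huV : u ∈ V (n + 1) :=
      sub_mem hx (hVmono n.le_succ ((V n).starProjection_apply_mem x))
    refine ⟨((‖u‖⁻¹ : ℝ) : ℂ) • u, Submodule.smul_mem _ _ huV, ?_, fun y hy => ?_⟩
    · rw [norm_smul]
      simp [hu0]
    · rw [inner_smul_left, Submodule.inner_left_of_mem_orthogonal hy huo, mul_zero]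
  choose e heV henorm heorth using hex
  have hfar {m n : ℕ} (hmn : m < n) : ‖μ‖ ≤ ‖R (e n) - R (e m)‖ := by
    have h1 : ⟪e n, R (e n) - R (e m)⟫_ℂ = μ := by
      have : R (e n) = A (e n) + μ • e n := by simp [hA]
      rw [this, inner_sub_right, inner_add_right, heorth n _ (hAV n (heV n)),
        heorth n _ (hVmono hmn (hRV m (heV m))), inner_smul_right, inner_self_eq_norm_sq_to_K,
        henorm]
      simp
    calc ‖μ‖ = ‖⟪e n, R (e n) - R (e m)⟫_ℂ‖ := by rw [h1]
      _ ≤ ‖e n‖ * ‖R (e n) - R (e m)‖ := norm_inner_le_norm _ _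
      _ = _ := by rw [henorm, one_mul]
  obtain ⟨K, hK, hK'⟩ := hR.image_closedBall_subset_compact 1
  obtain ⟨y, -, ψ, hψ, hψy⟩ := hK.tendsto_subseq (x := fun n => R (e n))
    (fun n ↦ hK' ⟨e n, by simp [henorm], rfl⟩)
  have hcauchy := hψy.cauchySeq
  rw [Metric.cauchySeq_iff'] at hcauchy
  obtain ⟨n, hn⟩ := hcauchy ‖μ‖ (by positivity)
  have h1 : ‖R (e (ψ (n + 1))) - R (e (ψ n))‖ < ‖μ‖ := by
    simpa [dist_eq_norm_sub] using hn (n + 1)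
  exact h1.not_ge (hfar (hψ n.lt_succ_self))

/-- A closed invariant subspace containing all root vectors of a compact operator for `μ ≠ 0`
contains every eigenvector for `μ` modulo that subspace. -/
theorem IsCompactOperator.mem_of_sub_smul_mem {R : H →L[ℂ] H} (hR : IsCompactOperator R)
    {μ : ℂ} (hμ : μ ≠ 0) {N : Submodule ℂ H} (hN : IsClosed (N : Set H))
    (hRN : ∀ x ∈ N, R x ∈ N) (hker : ∀ (n : ℕ) (x : H), ((R - μ • 1) ^ n) x = 0 → x ∈ N)
    {v : H} (hv : R v - μ • v ∈ N) : v ∈ N := by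
  obtain ⟨k, hk⟩ := hR.exists_ker_pow_succ_le hμ
  set A := R - μ • 1 with hA
  have hAN (n : ℕ) : ∀ x ∈ N, (A ^ n) x ∈ N := by
    induction n with
    | zero => simp
    | succ n ih =>
      intro x hx
      rw [pow_succ, mul_apply_eq_comp]
      exact ih _ (by simpa [hA] using sub_mem (hRN x hx) (N.smul_mem μ hx))
  have hstab (j : ℕ) : ∀ x, (A ^ (k + j)) x = 0 → (A ^ k) x = 0 := by
    induction j with
    | zero => simp
    | succ j ih =>
      intro x hx
      refine ih x ?_
      have h1 : (A ^ (k + 1)) ((A ^ j) x) = 0 := by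
        rw [← mul_apply_eq_comp, ← pow_add, ← hx]
        congr 2
        omega
      rw [pow_add, mul_apply_eq_comp]
      exact hk _ h1
  obtain ⟨K, hK, hAK⟩ := exists_sub_smul_pow_eq_smul_one_add_compact hR μ (k + 1)
  rw [← hA] at hAK
  set c := (-μ) ^ (k + 1) with hcdef
  have hc : c ≠ 0 := pow_ne_zero _ (neg_ne_zero.mpr hμ)
  have hAK' (x : H) : (A ^ (k + 1)) x = c • x + K x := by rw [hAK]; simp
  let E : Submodule ℂ H := (A ^ (k + 1)).ker
  have : CompleteSpace E := (A ^ (k + 1)).isClosed_ker.completeSpace_coe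
  let Q : H →L[ℂ] H := E.starProjection
  have hQmem (x : H) : (A ^ (k + 1)) (Q x) = 0 := E.starProjection_apply_mem x
  have hQN (x : H) : Q x ∈ N := hker _ _ (hQmem x)
  have hQ : IsCompactOperator Q := by
    have h1 : (Q : H → H) = (-c⁻¹) • (K ∘ Q) := by
      ext x
      have h2 : K (Q x) = -c • Q x := by
        have := hAK' (Q x)
        rw [hQmem] at this
        rw [neg_smul]
        exact (neg_eq_of_add_eq_zero_right this.symm).symm
      simp [h2, smul_smul, hc]
    rw [h1]
    exact (hK.comp_clm Q).smul _
  have hinj : ∀ x, c • x + (K + Q) x = 0 → x = 0 := by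
    intro x hx
    have h1 : (A ^ (k + 1)) x + Q x = 0 := by
      rw [hAK', ← hx, add_apply]
      abel
    have h2 : (A ^ (k + (k + 2))) x = 0 := by
      have := congrArg (A ^ (k + 1)) h1
      rw [map_add, hQmem, add_zero, map_zero, ← mul_apply_eq_comp, ← pow_add] at this
      rw [← this]
      congr 2
      omega
    have h3 : (A ^ (k + 1)) x = 0 := by
      rw [pow_succ', mul_apply_eq_comp, hstab _ _ h2, map_zero]
    rw [h3, zero_add] at h1
    rw [← h1]
    exact (Submodule.starProjection_eq_self_iff.mpr h3).symm
  have hinv : ∀ x ∈ N, (K + Q) x ∈ N := by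
    intro x hx
    have h1 : (K + Q) x = (A ^ (k + 1)) x - c • x + Q x := by
      rw [hAK', add_apply]
      abel
    rw [h1]
    exact add_mem (sub_mem (hAN _ x hx) (N.smul_mem c hx)) (hQN x)
  have hDv : c • v + (K + Q) v ∈ N := by
    have h1 : c • v + (K + Q) v = (A ^ k) (A v) + Q v := by
      rw [← mul_apply_eq_comp, ← pow_succ, hAK', add_apply]
      abel
    rw [h1]
    exact add_mem (hAN k _ (by simpa [hA] using hv)) (hQN v)
  obtain ⟨x, hx, hxv⟩ := (hK.add hQ).exists_mem_smul_add_eq (L := K + Q) hc hinj hN hinv hDv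
  have h1 : v - x = 0 := by
    refine hinj _ ?_
    rw [smul_sub, map_sub]
    rw [← sub_eq_zero] at hxv
    rw [← neg_eq_zero, ← hxv]
    abel
  rwa [sub_eq_zero.mp h1]

end CompactOperator

namespace Op

section Resolvent

variable {H : Type*} [NormedAddCommGroup H] [InnerProductSpace ℂ H] {T : Op H} {z : ℂ}
  {R : H →L[ℂ] H}

theorem IsResolventAt.app_apply (h : T.IsResolventAt z R) (x : H) :
    T.app (R x) = z • R x + x := by
  rw [← sub_eq_iff_eq_add']
  exact h.2.1 x

theorem IsResolventAt.injective (h : T.IsResolventAt z R) {x : H} (hx : R x = 0) : x = 0 := by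
  simpa [hx] using (h.2.1 x).symm

theorem IsResolventAt.shift_comm (h : T.IsResolventAt z R) (lam : ℂ) {x : H} (hx : x ∈ T.dom) :
    T.shift lam (R x) = R (T.shift lam x) := by
  have h1 := h.2.2 x hx
  rw [map_sub, map_smul, sub_eq_iff_eq_add] at h1
  simp only [shift, LinearMap.sub_apply, LinearMap.smul_apply, LinearMap.id_apply, map_sub,
    map_smul, h.app_apply, h1]
  module

theorem IsResolventAt.eq_add_smul_mul (h : T.IsResolventAt z R) {w : ℂ} {S : H →L[ℂ] H}
    (hS : T.IsResolventAt w S) : S = R + (w - z) • (R * S) := by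
  ext x
  have h1 := h.2.2 (S x) (hS.1 x)
  rw [hS.app_apply, show w • S x + x - z • S x = x + (w - z) • S x by module, map_add,
    map_smul] at h1
  simpa using h1.symm

theorem IsResolventAt.isRootVector_apply (h : T.IsResolventAt z R) {lam : ℂ} {x : H}
    (hx : T.IsRootVector lam x) : T.IsRootVector lam (R x) := by
  obtain ⟨hx0, k, hk, hdom, hzero⟩ := hx
  have hcomm : ∀ j ≤ k, ((T.shift lam) ^ j) (R x) = R (((T.shift lam) ^ j) x) := by
    intro j
    induction j with
    | zero => simp
    | succ j ih =>
      intro hj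
      rw [pow_succ', Module.End.mul_apply, ih (by omega), h.shift_comm lam (hdom j (by omega)),
        Module.End.mul_apply]
  refine ⟨fun h0 => hx0 (h.injective h0), k, hk, fun j hj => ?_, ?_⟩
  · rw [hcomm j hj.le]
    exact h.1 _
  · rw [hcomm k le_rfl, hzero, map_zero]

theorem IsResolventAt.apply_mem_rootSystem (h : T.IsResolventAt z R) {x : H}
    (hx : x ∈ T.rootSystem) : R x ∈ T.rootSystem := by
  have : T.rootSystem ≤ T.rootSystem.comap (R : H →ₗ[ℂ] H) := by
    refine Submodule.span_le.mpr ?_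
    rintro y ⟨lam, hy⟩
    exact Submodule.subset_span ⟨lam, h.isRootVector_apply hy⟩
  exact this hx

theorem exists_apply_eq_of_sub_smul_pow_eq_zero (R : H →L[ℂ] H) {μ : ℂ} (hμ : μ ≠ 0) (n : ℕ) :
    ∀ x, ((R - μ • 1) ^ n) x = 0 → ∃ u, ((R - μ • 1) ^ n) u = 0 ∧ R u = x := by
  induction n with
  | zero => exact fun x hx => ⟨0, by simp, by simpa using hx.symm⟩
  | succ n ih =>
    intro x hx
    obtain ⟨u, hu, hux⟩ := ih ((R - μ • 1) x) (by rwa [pow_succ] at hx)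
    refine ⟨μ⁻¹ • (x - u), ?_, ?_⟩
    · rw [map_smul, map_sub, hx, pow_succ', mul_apply_eq_comp, hu]
      simp
    · rw [map_smul, map_sub, hux]
      simp [smul_smul, hμ]

theorem IsResolventAt.shift_pow_eq_zero (h : T.IsResolventAt z R) {μ : ℂ} (hμ : μ ≠ 0) (n : ℕ) :
    ∀ x, ((R - μ • 1) ^ n) x = 0 →
      (∀ j < n, ((T.shift (z + μ⁻¹)) ^ j) x ∈ T.dom) ∧ ((T.shift (z + μ⁻¹)) ^ n) x = 0 := by
  induction n with
  | zero => intro x hx; simpa using hx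
  | succ n ih =>
    intro x hx
    obtain ⟨u, hu, rfl⟩ := exists_apply_eq_of_sub_smul_pow_eq_zero R hμ _ x hx
    have hshift : T.shift (z + μ⁻¹) (R u) = -μ⁻¹ • (R - μ • 1) u := by
      simp only [shift, LinearMap.sub_apply, LinearMap.smul_apply, LinearMap.id_apply,
        h.app_apply, sub_apply, smul_apply,
        one_apply_eq_self, smul_sub, smul_smul]
      rw [neg_mul, inv_mul_cancel₀ hμ]
      module
    obtain ⟨hd, h0⟩ := ih (T.shift (z + μ⁻¹) (R u)) (by
      rw [hshift, map_smul, ← mul_apply_eq_comp, ← pow_succ, hu, smul_zero])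
    refine ⟨fun j hj => ?_, by rw [pow_succ, Module.End.mul_apply, h0]⟩
    cases j with
    | zero => exact h.1 u
    | succ j =>
      rw [pow_succ, Module.End.mul_apply]
      exact hd j (by omega)

theorem IsResolventAt.mem_rootSystem_of_sub_smul_pow_eq_zero (h : T.IsResolventAt z R) {μ : ℂ}
    (hμ : μ ≠ 0) {n : ℕ} {x : H} (hx : ((R - μ • 1) ^ n) x = 0) : x ∈ T.rootSystem := by
  by_cases hx0 : x = 0
  · rw [hx0]
    exact zero_mem _
  have hn : 0 < n := by
    rcases Nat.eq_zero_or_pos n with rfl | hn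
    · exact absurd (by simpa using hx) hx0
    · exact hn
  obtain ⟨hd, h0⟩ := h.shift_pow_eq_zero hμ n x hx
  exact Submodule.subset_span ⟨_, hx0, n, hn, hd, h0⟩

theorem IsResolventAt.denseRange (h : T.IsResolventAt z R) (hdense : Dense (T.dom : Set H)) :
    DenseRange R :=
  hdense.mono fun x hx => ⟨_, h.2.2 x hx⟩

end Resolvent

end Op

/-- If `T` is densely defined with compact resolvent and there is a sequence
of bounded open regions `U k` covering `ℂ`, with boundaries in `ρ(T)` on which the resolvent
is uniformly bounded by `C`, then the system of root subspaces of `T` is complete. -/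
theorem statement1 {H : Type*} [NormedAddCommGroup H] [InnerProductSpace ℂ H]
    [CompleteSpace H] (T : Op H)
    (hdense : Dense (T.dom : Set H))
    (hcompact : T.HasCompactResolvent)
    (U : ℕ → Set ℂ)
    (hopen : ∀ k, IsOpen (U k))
    (hbounded : ∀ k, Bornology.IsBounded (U k))
    (hcover : (⋃ k, U k) = Set.univ)
    (hbdry : ∀ k, frontier (U k) ⊆ T.resolventSet)
    (C : ℝ) (hC : 0 ≤ C)
    (hres : ∀ k, ∀ z ∈ frontier (U k), ∀ R : H →L[ℂ] H,
      T.IsResolventAt z R → ‖R‖ ≤ C) :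
    T.CompleteRootSystem := by
  obtain ⟨z₀, R, hR, hRc⟩ := hcompact
  set N := T.rootSystem.topologicalClosure with hNdef
  have hN : IsClosed (N : Set H) := T.rootSystem.isClosed_topologicalClosure
  have : CompleteSpace N := hN.completeSpace_coe
  have hRN : ∀ x ∈ N, R x ∈ N := fun x hx =>
    map_mem_closure R.continuous hx fun _ hy => hR.apply_mem_rootSystem hy
  have hker {μ : ℂ} (hμ : μ ≠ 0) (n : ℕ) (x : H) (hx : ((R - μ • 1) ^ n) x = 0) : x ∈ N :=
    T.rootSystem.le_topologicalClosure (hR.mem_rootSystem_of_sub_smul_pow_eq_zero hμ hx)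
  let P : H →L[ℂ] H := Nᗮ.starProjection
  have hsub (x : H) : x - P x ∈ N := by
    have := Nᗮ.sub_starProjection_mem_orthogonal x
    rwa [N.orthogonal_orthogonal] at this
  have hPN {x : H} : P x = 0 ↔ x ∈ N := by
    rw [Submodule.starProjection_apply_eq_zero_iff, N.orthogonal_orthogonal]
  set B : H →L[ℂ] H := P * R with hB
  have hBP : B * P = B := by
    ext x
    have h1 : P (R (x - P x)) = 0 := hPN.mpr (hRN _ (hsub x))
    rw [map_sub, map_sub, sub_eq_zero] at h1
    exact h1.symm
  have hBc : IsCompactOperator B := hRc.clm_comp P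
  have hunit (w : ℂ) : IsUnit (1 - w • B) := by
    rcases eq_or_ne w 0 with rfl | hw
    · simp
    rcases hBc.hasEigenvalue_or_mem_resolventSet (inv_ne_zero hw) with h | h
    · obtain ⟨v, hv⟩ := h.exists_hasEigenvector
      have hv1 : P (R v) = w⁻¹ • v := hv.apply_eq_smul
      have hvN : v ∈ N := by
        refine hRc.mem_of_sub_smul_mem (inv_ne_zero hw) hN hRN (hker (inv_ne_zero hw)) ?_
        rw [← hv1]
        exact hsub _
      have hv0 : w⁻¹ • v = 0 := by rw [← hv1]; exact hPN.mpr (hRN v hvN)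
      exact absurd ((smul_eq_zero.mp hv0).resolve_left (inv_ne_zero hw)) hv.2
    · rw [spectrum.mem_resolventSet_iff] at h
      have h1 : 1 - w • B = algebraMap ℂ (H →L[ℂ] H) w * (algebraMap ℂ (H →L[ℂ] H) w⁻¹ - B) := by
        rw [mul_sub, ← map_mul, mul_inv_cancel₀ hw, map_one, ← Algebra.smul_def]
      rw [h1]
      exact ((isUnit_iff_ne_zero.mpr hw).map (algebraMap ℂ (H →L[ℂ] H))).mul h
  let G : ℂ → H →L[ℂ] H := fun z => Ring.inverse (1 - (z - z₀) • B) * B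
  have hGdiff : Differentiable ℂ G := by
    intro z
    have h1 : DifferentiableAt ℂ (fun z : ℂ => (1 : H →L[ℂ] H) - (z - z₀) • B) z := by fun_prop
    have h2 : DifferentiableAt ℂ (fun z : ℂ => Ring.inverse ((1 : H →L[ℂ] H) - (z - z₀) • B)) z :=
      h1.inverse (hunit (z - z₀))
    exact h2.mul_const B
  have hGres {z : ℂ} {S : H →L[ℂ] H} (hS : T.IsResolventAt z S) : G z = P * S := by
    have h1 : (1 - (z - z₀) • B) * (P * S) = B := by
      have h2 : P * S = B + (z - z₀) • (B * S) := by
        conv_lhs => rw [hR.eq_add_smul_mul hS]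
        rw [mul_add, mul_smul_comm, hB, mul_assoc]
      rw [sub_mul, one_mul, smul_mul_assoc, ← mul_assoc, hBP, h2, add_sub_cancel_right]
    change Ring.inverse (1 - (z - z₀) • B) * B = _
    have h2 := Ring.inverse_mul_cancel_left (1 - (z - z₀) • B) (P * S) (hunit _)
    rwa [h1] at h2
  have hGbound (z : ℂ) : ‖G z‖ ≤ C := by
    obtain ⟨k, hk⟩ := Set.mem_iUnion.mp (hcover ▸ Set.mem_univ z)
    refine Complex.norm_le_of_forall_mem_frontier_norm_le (hbounded k) hGdiff.diffContOnCl
      (fun w hw => ?_) (subset_closure hk)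
    obtain ⟨S, hS⟩ := hbdry k hw
    rw [hGres hS]
    calc ‖P * S‖ ≤ ‖P‖ * ‖S‖ := norm_mul_le _ _
      _ ≤ 1 * C := mul_le_mul Nᗮ.starProjection_norm_le (hres k w hw S hS) (norm_nonneg _)
          zero_le_one
      _ = C := one_mul C
  have hGconst : G (z₀ + 1) = G z₀ := by
    refine hGdiff.apply_eq_apply_of_bounded ?_ _ _
    rw [isBounded_iff_forall_norm_le]
    exact ⟨C, by rintro _ ⟨z, rfl⟩; exact hGbound z⟩
  have hBB : B * B = 0 := by
    have h1 : Ring.inverse (1 - B) * B = B := by simpa [G] using hGconst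
    have h2 : (1 - B) * B = B := by
      have h3 := Ring.mul_inverse_cancel_left (1 - B) B (by simpa using hunit 1)
      rwa [h1] at h3
    simpa [sub_mul] using h2
  have hRR (x : H) : R (R x) ∈ N := by
    refine hPN.mp ?_
    have h1 : B * R = 0 := by rw [← hBP, mul_assoc, ← hB, hBB]
    exact DFunLike.congr_fun h1 x
  have hrange : DenseRange (R ∘ R) :=
    (hR.denseRange hdense).comp (hR.denseRange hdense) R.continuous
  have hNdense : Dense (N : Set H) := hrange.mono (by rintro _ ⟨x, rfl⟩; exact hRR x)
  rw [hNdef, Submodule.topologicalClosure_coe, dense_closure] at hNdense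
  exact hNdense
end

section
/- Let P_0,…,P_n be bounded projections (idempotent bounded linear operators) on a complex Hilbert space H with P_j P_k = 0 for j ≠ k, and set C = max{‖Σ_{k=0}^{n} ε_k P_k‖ : ε_k = ±1}. Then for every x ∈ H, C^{-2}·Σ_{k=0}^{n}‖P_k x‖² ≤ ‖Σ_{k=0}^{n} P_k x‖² ≤ C²·Σ_{k=0}^{n}‖P_k x‖². -/
open scoped InnerProductSpace ComplexInnerProductSpace
open Filter Metric Complex

/-- Averaging `‖z + ∑ ±yₖ‖²` over all choices of signs yields `‖z‖² + ∑ ‖yₖ‖²`. -/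
theorem sum_signs_norm_add_sum_sq {E : Type*} [NormedAddCommGroup E] [InnerProductSpace ℂ E]
    (n : ℕ) (y : Fin n → E) (z : E) :
    ∑ σ : Fin n → Bool, ‖z + ∑ k, (if σ k then (1 : ℝ) else (-1 : ℝ)) • y k‖ ^ 2 =
      2 ^ n * (‖z‖ ^ 2 + ∑ k, ‖y k‖ ^ 2) := by
  induction n generalizing z with
  | zero => simp
  | succ n ih =>
    rw [← (Fin.consEquiv fun _ : Fin (n + 1) => Bool).sum_comp, Fintype.sum_prod_type]
    simp only [Fin.consEquiv_apply, Fin.sum_univ_succ, Fin.cons_zero, Fin.cons_succ,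
      ← add_assoc, ih, Fintype.sum_bool]
    have h := parallelogram_law_with_norm ℂ z (y 0)
    simp only [if_true, Bool.false_eq_true, if_false, one_smul, neg_smul, ← sub_eq_add_neg]
    rw [pow_succ]
    linear_combination 2 ^ n * h

theorem sum_signs_norm_sum_sq {E : Type*} [NormedAddCommGroup E] [InnerProductSpace ℂ E]
    (n : ℕ) (y : Fin n → E) :
    ∑ σ : Fin n → Bool, ‖∑ k, (if σ k then (1 : ℝ) else (-1 : ℝ)) • y k‖ ^ 2 =
      2 ^ n * ∑ k, ‖y k‖ ^ 2 := by
  simpa using sum_signs_norm_add_sum_sq n y 0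

/-- A combination of mutually annihilating projections acts diagonally on sums of vectors from
their ranges. -/
theorem sum_smul_proj_apply_sum {E : Type*} [NormedAddCommGroup E] [InnerProductSpace ℂ E]
    {ι : Type*} [Fintype ι] {P : ι → E →L[ℂ] E}
    (hproj : ∀ k, (P k).comp (P k) = P k) (horth : ∀ j k, j ≠ k → (P j).comp (P k) = 0)
    (a b : ι → ℝ) (x : E) :
    (∑ k, a k • P k) (∑ k, b k • P k x) = ∑ k, (a k * b k) • P k x := by
  have hP (j k : ι) (hjk : j ≠ k) : P j (P k x) = 0 := DFunLike.congr_fun (horth j k hjk) x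
  have hP' (k : ι) : P k (P k x) = P k x := DFunLike.congr_fun (hproj k) x
  have hsmul (k : ι) (r : ℝ) (v : E) : P k (r • v) = r • P k v := by
    simp
  simp only [sum_apply, smul_apply, map_sum, hsmul]
  refine Finset.sum_congr rfl fun j _ => ?_
  rw [Finset.sum_eq_single j (fun k _ hk => by rw [hP k j hk, smul_zero, smul_zero]) (by simp),
    hP', smul_smul, mul_comm]

/-- for projections `P₀,…,Pₙ` with `PⱼPₖ = 0` for `j ≠ k` and `C` an upper
bound for the norms of all signed sums `∑ ±Pₖ` (in particular for their maximum), one has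
`C⁻² ∑‖Pₖx‖² ≤ ‖∑Pₖx‖² ≤ C² ∑‖Pₖx‖²` for all `x`. -/
theorem statement6 {H : Type*} [NormedAddCommGroup H] [InnerProductSpace ℂ H]
    (n : ℕ) (P : Fin (n + 1) → H →L[ℂ] H)
    (hproj : ∀ k, (P k).comp (P k) = P k)
    (horth : ∀ j k, j ≠ k → (P j).comp (P k) = 0)
    (C : ℝ)
    (hCmax : ∃ σ : Fin (n + 1) → Bool,
      C = ‖∑ k, (if σ k then (1 : ℝ) else (-1 : ℝ)) • P k‖)
    (hCbound : ∀ σ : Fin (n + 1) → Bool,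
      ‖∑ k, (if σ k then (1 : ℝ) else (-1 : ℝ)) • P k‖ ≤ C)
    (x : H) :
    (C ^ 2)⁻¹ * ∑ k, ‖P k x‖ ^ 2 ≤ ‖∑ k, P k x‖ ^ 2 ∧
      ‖∑ k, P k x‖ ^ 2 ≤ C ^ 2 * ∑ k, ‖P k x‖ ^ 2 := by
  have hC0 : 0 ≤ C := by
    obtain ⟨σ, rfl⟩ := hCmax
    exact norm_nonneg _
  have hsum := sum_signs_norm_sum_sq (n + 1) fun k => P k x
  have hle (σ : Fin (n + 1) → Bool) (v : H) :
      ‖(∑ k, (if σ k then (1 : ℝ) else (-1 : ℝ)) • P k) v‖ ^ 2 ≤ C ^ 2 * ‖v‖ ^ 2 := by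
    rw [← mul_pow]
    exact pow_le_pow_left₀ (norm_nonneg _)
      (ContinuousLinearMap.le_of_opNorm_le _ (hCbound σ) v) 2
  have hpow : (0 : ℝ) < 2 ^ (n + 1) := by positivity
  have hcard (r : ℝ) : ∑ _σ : Fin (n + 1) → Bool, r = 2 ^ (n + 1) * r := by simp
  have hlower : ∑ k, ‖P k x‖ ^ 2 ≤ C ^ 2 * ‖∑ k, P k x‖ ^ 2 := by
    refine le_of_mul_le_mul_left ?_ hpow
    rw [← hsum, ← hcard]
    refine Finset.sum_le_sum fun σ _ => ?_
    have h := sum_smul_proj_apply_sum hproj horth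
      (fun k => if σ k then (1 : ℝ) else (-1 : ℝ)) (fun _ => 1) x
    simp only [one_smul, mul_one] at h
    rw [← h]
    exact hle σ _
  have hupper : ‖∑ k, P k x‖ ^ 2 ≤ C ^ 2 * ∑ k, ‖P k x‖ ^ 2 := by
    refine le_of_mul_le_mul_left ?_ hpow
    rw [mul_left_comm, ← hsum, ← hcard, Finset.mul_sum]
    refine Finset.sum_le_sum fun σ _ => ?_
    have h := sum_smul_proj_apply_sum hproj horth
      (fun k => if σ k then (1 : ℝ) else (-1 : ℝ))
      (fun k => if σ k then (1 : ℝ) else (-1 : ℝ)) x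
    have hsq (k : Fin (n + 1)) : (if σ k then (1 : ℝ) else (-1 : ℝ)) *
        (if σ k then (1 : ℝ) else (-1 : ℝ)) = 1 := by split_ifs <;> norm_num
    simp only [hsq, one_smul] at h
    rw [← h]
    exact hle σ _
  refine ⟨?_, hupper⟩
  rcases hC0.eq_or_lt with rfl | hC
  · simp
  · exact (inv_mul_le_iff₀ (by positivity)).2 hlower
end

section
/- Let G be a normal operator on a complex Hilbert space H whose spectrum lies on finitely many rays e^{iθ_j}ℝ_{≥0} from the origin, with 0 ≤ θ_j < 2π for j = 1,…,n. Let T = G + S (with D(T) = D(G)) where S is p-subordinate to G with bound b and 0 ≤ p < 1. Then for every α > b there exists r_0 > 0 such that σ(T) ⊆ B_{r_0}(0) ∪ ⋃_{j=1}^{n} {e^{iθ_j}(x+iy) : x ≥ 0, |y| ≤ αx^{p}}. Moreover, if G has compact resolvent, then T has compact resolvent. -/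
open scoped InnerProductSpace ComplexInnerProductSpace
open Filter Metric Complex

/-- The closed ray `e^{iθ} ℝ≥0`. -/
def rayFrom (θ : ℝ) : Set ℂ :=
  {z | ∃ x : ℝ, 0 ≤ x ∧ z = (x : ℂ) * Complex.exp (θ * Complex.I)}

/-- The parabola-shaped region `{e^{iθ}(x+iy) : x ≥ 0, |y| ≤ α x^p}` around the ray of
angle `θ`. -/
def parabRegion (θ α p : ℝ) : Set ℂ :=
  {z | ∃ x y : ℝ, 0 ≤ x ∧ |y| ≤ α * x ^ p ∧
    z = Complex.exp (θ * Complex.I) * ((x : ℂ) + (y : ℂ) * Complex.I)}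

namespace Op

variable {H : Type*} [NormedAddCommGroup H] [InnerProductSpace ℂ H]

/-- The resolvent identity. -/
theorem IsResolventAt.sub_eq {T : Op H} {z w : ℂ} {R R' : H →L[ℂ] H}
    (hR : T.IsResolventAt z R) (hR' : T.IsResolventAt w R') :
    R' - R = (w - z) • (R * R') := by
  ext x
  have h1 := hR.2.2 (R' x) (hR'.1 x)
  have h2 : T.app (R' x) - z • R' x = x + (w - z) • R' x := by
    rw [sub_smul, ← add_sub_assoc, add_sub_right_comm]
    nth_rewrite 3 [← hR'.2.1 x]
    abel
  rw [h2, map_add, map_smul] at h1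
  simp only [sub_apply, smul_apply]
  exact sub_eq_of_eq_add' h1.symm

theorem IsResolventAt.isUnit_one_sub_smul {T : Op H} {z w : ℂ} {R R' : H →L[ℂ] H}
    (hR : T.IsResolventAt z R) (hR' : T.IsResolventAt w R') :
    IsUnit (1 - (w - z) • R) := by
  have h1 := hR.sub_eq hR'
  have h2 := hR'.sub_eq hR
  refine isUnit_iff_exists.2 ⟨1 + (w - z) • R', ?_, ?_⟩
  · rw [sub_mul, one_mul, mul_add, mul_one, smul_mul_smul_comm, mul_smul, ← h1, smul_sub]
    abel
  · rw [add_mul, one_mul, mul_sub, mul_one, smul_mul_smul_comm, mul_smul]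
    rw [← neg_sub w z, neg_smul, ← neg_sub R', neg_inj] at h2
    rw [← h2, smul_sub]
    abel

/-- A nonzero spectral value of a resolvent comes from a spectral value of the operator. -/
theorem IsResolventAt.add_inv_mem_spec {T : Op H} {z μ : ℂ} {R : H →L[ℂ] H}
    (hR : T.IsResolventAt z R) (hμ : μ ∈ spectrum ℂ R) (h0 : μ ≠ 0) :
    z + μ⁻¹ ∈ T.spec := by
  rintro ⟨R', hR'⟩
  have h := hR.isUnit_one_sub_smul hR'
  rw [add_sub_cancel_left] at h
  rw [spectrum.mem_iff] at hμ
  refine hμ ?_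
  have h2 : algebraMap ℂ (H →L[ℂ] H) μ - R = Units.mk0 μ h0 • (1 - μ⁻¹ • R) := by
    rw [Units.smul_mk0, smul_sub, smul_smul, mul_inv_cancel₀ h0, one_smul,
      Algebra.algebraMap_eq_smul_one]
  rw [h2]
  exact h.smul _

/-- The resolvent of a normal operator is a normal bounded operator. -/
theorem IsResolventAt.isStarNormal [CompleteSpace H] {G : Op H} (hG : G.IsNormalOp) {z : ℂ}
    {R : H →L[ℂ] H} (hR : G.IsResolventAt z R) : IsStarNormal R := by
  obtain ⟨hdense, -, Gs, ⟨hdom, hadj⟩, hD, hnorm⟩ := hG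
  let A : H →ₗ[ℂ] H := G.app - z • LinearMap.id
  let B : H →ₗ[ℂ] H := Gs.app - (starRingEnd ℂ z) • LinearMap.id
  have hA (x) : A x = G.app x - z • x := rfl
  have hB (x) : B x = Gs.app x - (starRingEnd ℂ z) • x := rfl
  have hAB : ∀ x ∈ G.dom, ∀ y ∈ G.dom, ⟪A x, y⟫_ℂ = ⟪x, B y⟫_ℂ := by
    intro x hx y hy
    rw [hA, hB, inner_sub_left, inner_sub_right, hadj y (hD ▸ hy) x hx, inner_smul_left,
      inner_smul_right]
  have hnAB : ∀ x ∈ G.dom, ‖A x‖ = ‖B x‖ := by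
    intro x hx
    have h1 : ‖A x‖ ^ 2 = ‖B x‖ ^ 2 := by
      rw [hA, hB, @norm_sub_sq ℂ, @norm_sub_sq ℂ, hnorm x hx, norm_smul, norm_smul,
        inner_smul_right, inner_smul_right, hadj x (hD ▸ hx) x hx, RCLike.norm_conj,
        ← inner_conj_symm x]
      congr 3
      rw [← RCLike.conj_re, map_mul, Complex.conj_conj]
    exact (sq_eq_sq₀ (norm_nonneg _) (norm_nonneg _)).1 h1
  have hinner : ∀ x ∈ G.dom, ∀ y ∈ G.dom, ⟪A x, A y⟫_ℂ = ⟪B x, B y⟫_ℂ := by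
    intro x hx y hy
    have hI := G.dom.smul_mem Complex.I hy
    rw [inner_eq_sum_norm_sq_div_four (𝕜 := ℂ), inner_eq_sum_norm_sq_div_four (𝕜 := ℂ)]
    simp only [RCLike.I_to_complex, ← map_smul, ← map_add, ← map_sub]
    rw [hnAB _ (add_mem hx hy), hnAB _ (sub_mem hx hy), hnAB _ (add_mem hx hI),
      hnAB _ (sub_mem hx hI)]
  have hAR (x) : A (R x) = x := hR.2.1 x
  have hstar : ∀ y, ∀ u ∈ G.dom, ⟪A u, star R y⟫_ℂ = ⟪u, y⟫_ℂ := by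
    intro y u hu
    rw [ContinuousLinearMap.star_eq_adjoint, ContinuousLinearMap.adjoint_inner_right]
    congr 1
    exact hR.2.2 u hu
  have hmem : ∀ y, star R y ∈ G.dom := by
    intro y
    rw [hD, ← SetLike.mem_coe, hdom]
    refine ⟨y + (starRingEnd ℂ z) • star R y, fun x hx => ?_⟩
    rw [inner_add_right, ← hstar y x hx, inner_smul_right, hA, inner_sub_left, inner_smul_left]
    ring
  have hBs : ∀ y, B (star R y) = y := by
    intro y
    refine ext_inner_left ℂ fun v => ?_
    have h2 : ∀ u ∈ G.dom, ⟪u, B (star R y)⟫_ℂ = ⟪u, y⟫_ℂ := fun u hu => by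
      rw [← hAB u hu _ (hmem y), hstar y u hu]
    exact congrFun (Continuous.ext_on hdense (by fun_prop) (by fun_prop) h2) v
  rw [isStarNormal_iff]
  ext x
  change star R (R x) = R (star R x)
  set v := star R (R x) with hv
  set w := R (star R x) with hw
  have hvD : v ∈ G.dom := hmem _
  have hwD : w ∈ G.dom := hR.1 _
  have key : ∀ u ∈ G.dom, ⟪A u, A v⟫_ℂ = ⟪A u, A w⟫_ℂ := by
    intro u hu
    rw [hinner u hu v hvD, hv, hBs, hw, hAR, hstar x u hu, ← inner_conj_symm,
      ← hAB _ (hR.1 x) u hu, hAR, inner_conj_symm]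
  have h4 : A v = A w := by
    refine ext_inner_left ℂ fun t => ?_
    have := key (R t) (hR.1 t)
    rwa [hAR] at this
  rw [← hR.2.2 v hvD, ← hR.2.2 w hwD]
  exact congrArg R h4

theorem IsResolventAt.norm_le_inv [CompleteSpace H] {G : Op H} (hG : G.IsNormalOp) {z : ℂ}
    {R : H →L[ℂ] H} (hR : G.IsResolventAt z R) {d : ℝ} (hd : 0 < d)
    (hdist : ∀ w ∈ G.spec, d ≤ ‖w - z‖) : ‖R‖ ≤ d⁻¹ := by
  have hN := hR.isStarNormal hG
  have h1 := IsStarNormal.spectralRadius_eq_nnnorm R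
  have h2 : spectralRadius ℂ R ≤ ENNReal.ofReal d⁻¹ := by
    refine iSup₂_le fun μ hμ => ?_
    rw [← enorm_eq_nnnorm, ← ofReal_norm]
    refine ENNReal.ofReal_le_ofReal ?_
    rcases eq_or_ne μ 0 with rfl | h0
    · simpa using hd.le
    · have := hdist _ (hR.add_inv_mem_spec hμ h0)
      rw [add_sub_cancel_left, norm_inv] at this
      exact (le_inv_comm₀ hd (norm_pos_iff.2 h0)).1 this
  rw [h1] at h2
  have h3 := ENNReal.toReal_mono ENNReal.ofReal_ne_top h2
  rwa [ENNReal.toReal_ofReal (by positivity), ENNReal.coe_toReal, coe_nnnorm] at h3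

/-- If the perturbation composed with the resolvent is a strict contraction, the resolvent of the
perturbed operator is given by a Neumann series. -/
theorem IsResolventAt.addOp [CompleteSpace H] {G S : Op H} {z : ℂ} {R K : H →L[ℂ] H}
    (hR : G.IsResolventAt z R) (hK : ∀ x, K x = S.app (R x)) (hK1 : ‖K‖ < 1) :
    ∃ U : H →L[ℂ] H, (G.addOp S).IsResolventAt z (R * U) := by
  have hu : IsUnit (1 + K) := by
    rw [← sub_neg_eq_add]
    exact isUnit_one_sub_of_norm_lt_one (by rwa [norm_neg])
  obtain ⟨u, hu⟩ := hu
  have h1 (x) : (1 + K) ((↑u⁻¹ : H →L[ℂ] H) x) = x := by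
    rw [← hu]
    exact DFunLike.congr_fun u.mul_inv x
  have h2 (x) : (↑u⁻¹ : H →L[ℂ] H) ((1 + K) x) = x := by
    rw [← hu]
    exact DFunLike.congr_fun u.inv_mul x
  have h3 (y) : G.app (R y) + S.app (R y) - z • R y = (1 + K) y := by
    rw [add_sub_right_comm, hR.2.1, ← hK]
    rfl
  refine ⟨↑u⁻¹, fun x => hR.1 _, fun x => ?_, fun x hx => ?_⟩
  · exact (h3 _).trans (h1 x)
  · have h4 := hR.2.2 x hx
    have h5 := h3 (G.app x - z • x)
    rw [h4] at h5
    change R ((↑u⁻¹ : H →L[ℂ] H) (G.app x + S.app x - z • x)) = x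
    rw [h5, h2, h4]

/-- A normal operator with `p`-subordinate perturbation: resolvent points of the sum far enough from
the spectrum of the unperturbed operator. -/
theorem Subordinate.exists_isResolventAt [CompleteSpace H] {G S : Op H} (hG : G.IsNormalOp)
    {p b : ℝ} (hp0 : 0 ≤ p) (hp1 : p < 1) (hb : 0 ≤ b) (hsub : S.Subordinate G p b)
    {z : ℂ} {d : ℝ} (hd : 0 < d) (hdist : ∀ w ∈ G.spec, d ≤ ‖w - z‖)
    (hbd : b * (‖z‖ + d) ^ p < d) :
    ∃ R U : H →L[ℂ] H, G.IsResolventAt z R ∧ (G.addOp S).IsResolventAt z (R * U) := by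
  have hz : z ∈ G.resolventSet := by
    by_contra h
    have := hdist z h
    rw [sub_self, norm_zero] at this
    exact this.not_gt hd
  obtain ⟨R, hR⟩ := hz
  have hRn := hR.norm_le_inv hG hd hdist
  have hRx (x) : ‖R x‖ ≤ d⁻¹ * ‖x‖ := R.le_of_opNorm_le hRn x
  have hGR (x) : ‖G.app (R x)‖ ≤ (‖z‖ + d) * (d⁻¹ * ‖x‖) := by
    have h1 : G.app (R x) = x + z • R x := sub_eq_iff_eq_add.1 (hR.2.1 x)
    calc ‖G.app (R x)‖ ≤ ‖x‖ + ‖z‖ * ‖R x‖ := by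
          rw [h1, ← norm_smul]; exact norm_add_le _ _
      _ ≤ ‖x‖ + ‖z‖ * (d⁻¹ * ‖x‖) := by gcongr; exact hRx x
      _ = (‖z‖ + d) * (d⁻¹ * ‖x‖) := by field_simp; ring
  have hSR (x) : ‖S.app (R x)‖ ≤ b * (‖z‖ + d) ^ p / d * ‖x‖ := by
    have h0 : 0 ≤ d⁻¹ * ‖x‖ := by positivity
    calc ‖S.app (R x)‖ ≤ b * ‖R x‖ ^ (1 - p) * ‖G.app (R x)‖ ^ p := hsub.2 _ (hR.1 x)
      _ ≤ b * (d⁻¹ * ‖x‖) ^ (1 - p) * ((‖z‖ + d) * (d⁻¹ * ‖x‖)) ^ p := by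
          have hp : 0 ≤ 1 - p := by linarith
          gcongr
          · exact hRx x
          · exact hGR x
      _ = b * (‖z‖ + d) ^ p * ((d⁻¹ * ‖x‖) ^ (1 - p) * (d⁻¹ * ‖x‖) ^ p) := by
          rw [Real.mul_rpow (by positivity) h0]; ring
      _ = b * (‖z‖ + d) ^ p / d * ‖x‖ := by
          rw [← Real.rpow_add_of_nonneg h0 (by linarith) hp0, sub_add_cancel, Real.rpow_one]
          ring
  obtain ⟨U, hU⟩ := hR.addOp (S := S)
    (K := (S.app ∘ₗ (R : H →ₗ[ℂ] H)).mkContinuous _ hSR) (fun x => rfl)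
    ((LinearMap.mkContinuous_norm_le _ (by positivity) _).trans_lt ((div_lt_one hd).2 hbd))
  exact ⟨R, U, hR, hU⟩

theorem IsResolventAt.isCompactOperator {T : Op H} {z w : ℂ} {R R' : H →L[ℂ] H}
    (hR : T.IsResolventAt z R) (hR' : T.IsResolventAt w R') (hc : IsCompactOperator R) :
    IsCompactOperator R' := by
  have h := eq_add_of_sub_eq' (hR.sub_eq hR')
  have h2 : R' = R * (1 + (w - z) • R') := by
    rw [mul_add, mul_one, mul_smul_comm]
    exact h
  rw [h2]
  exact hc.comp_clm (1 + (w - z) • R')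

end Op

theorem isClosed_rayFrom (θ : ℝ) : IsClosed (rayFrom θ) := by
  have h : rayFrom θ = {z : ℂ | (Complex.exp (-(θ * Complex.I)) * z).im = 0 ∧
      0 ≤ (Complex.exp (-(θ * Complex.I)) * z).re} := by
    ext z
    constructor
    · rintro ⟨x, hx, rfl⟩
      have : Complex.exp (-(θ * Complex.I)) * (x * Complex.exp (θ * Complex.I)) = x := by
        rw [mul_left_comm, ← Complex.exp_add, neg_add_cancel, Complex.exp_zero, mul_one]
      rw [Set.mem_ofPred_eq, this]
      exact ⟨Complex.ofReal_im x, hx⟩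
    · rintro ⟨h1, h2⟩
      refine ⟨_, h2, ?_⟩
      have h3 : ((Complex.exp (-(θ * Complex.I)) * z).re : ℂ) =
          Complex.exp (-(θ * Complex.I)) * z := Complex.ext rfl (by simpa using h1.symm)
      rw [h3, mul_right_comm, ← Complex.exp_add, neg_add_cancel, Complex.exp_zero, one_mul]
  have hc : Continuous fun z : ℂ => Complex.exp (-(θ * Complex.I)) * z := by fun_prop
  rw [h]
  exact (isClosed_eq (Complex.continuous_im.comp hc) continuous_const).inter
    (isClosed_le continuous_const (Complex.continuous_re.comp hc))

theorem smul_mem_rayFrom {θ r : ℝ} (hr : 0 ≤ r) {w : ℂ} (hw : w ∈ rayFrom θ) :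
    (r : ℂ) * w ∈ rayFrom θ := by
  obtain ⟨x, hx, rfl⟩ := hw
  exact ⟨r * x, by positivity, by push_cast; ring⟩

theorem exists_notMem_iUnion_rayFrom {n : ℕ} (θ : Fin n → ℝ) :
    ∃ w : ℂ, w ∉ ⋃ j, rayFrom (θ j) := by
  have h1 : Set.InjOn (fun t : ℝ => Complex.exp (t * Complex.I)) (Set.Icc 0 1) := by
    intro s hs t ht hst
    refine Circle.exp_injOn_Icc (by linarith [Real.pi_gt_three]) hs ht (Circle.ext ?_)
    rw [Circle.coe_exp, Circle.coe_exp]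
    exact hst
  obtain ⟨_, ⟨t, -, rfl⟩, hw⟩ := ((Set.Icc_infinite one_pos).image h1).exists_notMem_finite
    (Set.finite_range fun j => Complex.exp (θ j * Complex.I))
  refine ⟨Complex.exp (t * Complex.I), fun h => hw ?_⟩
  obtain ⟨j, x, hx, hj⟩ := Set.mem_iUnion.1 h
  have h2 := congrArg norm hj
  rw [Complex.norm_exp_ofReal_mul_I, norm_mul, Complex.norm_exp_ofReal_mul_I, mul_one,
    Complex.norm_real, Real.norm_of_nonneg hx] at h2
  rw [← h2, Complex.ofReal_one, one_mul] at hj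
  exact ⟨j, hj.symm⟩

/-- Distance estimate from a point outside a parabolic region to the corresponding ray. -/
theorem le_norm_sub_of_notMem_parabRegion {θ α β p : ℝ} (hp0 : 0 ≤ p) (hp1 : p < 1) (hβ : 0 ≤ β)
    (hα : 0 ≤ α) {z : ℂ} (hz0 : z ≠ 0) (hz : z ∉ parabRegion θ α p)
    (ht1 : β * ‖z‖ ^ (p - 1) ≤ 1) (ht : β ≤ α * (1 - β * ‖z‖ ^ (p - 1)))
    {w : ℂ} (hw : w ∈ rayFrom θ) : β * ‖z‖ ^ p ≤ ‖w - z‖ := by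
  obtain ⟨s, hs, rfl⟩ := hw
  set e := Complex.exp (θ * Complex.I) with he
  have hen : ‖e‖ = 1 := Complex.norm_exp_ofReal_mul_I θ
  have he0 : e ≠ 0 := Complex.exp_ne_zero _
  obtain ⟨v, rfl⟩ : ∃ v, z = e * v := ⟨e⁻¹ * z, by field_simp⟩
  rw [norm_mul, hen, one_mul] at ht1 ht ⊢
  have hv0 : 0 < ‖v‖ := norm_pos_iff.2 (right_ne_zero_of_mul hz0)
  have hpow : ‖v‖ ^ p = ‖v‖ * ‖v‖ ^ (p - 1) := by
    rw [Real.rpow_sub_one hv0.ne']; field_simp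
  have hle : β * ‖v‖ ^ p ≤ ‖v‖ := by
    rw [hpow]; nlinarith
  have hnorm : ‖(s : ℂ) * e - e * v‖ = ‖(s : ℂ) - v‖ := by
    rw [mul_comm, ← mul_sub, norm_mul, hen, one_mul]
  rw [hnorm]
  rcases lt_or_ge v.re 0 with hre | hre
  · refine hle.trans ?_
    rw [Complex.norm_eq_sqrt_sq_add_sq, Complex.norm_eq_sqrt_sq_add_sq]
    apply Real.sqrt_le_sqrt
    simp only [Complex.sub_re, Complex.sub_im, Complex.ofReal_re, Complex.ofReal_im]
    nlinarith
  · have him : |v.im| ≤ ‖(s : ℂ) - v‖ := by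
      simpa using Complex.abs_im_le_norm ((s : ℂ) - v)
    refine le_trans ?_ him
    have h1 : α * v.re ^ p < |v.im| := by
      by_contra! h
      exact hz ⟨v.re, v.im, hre, h, by rw [Complex.re_add_im]⟩
    by_contra! h2
    have h3 : ‖v‖ ≤ v.re + |v.im| := by
      simpa [abs_of_nonneg hre] using Complex.norm_le_abs_re_add_abs_im v
    set t := β * ‖v‖ ^ (p - 1) with ht'
    have h4 : ‖v‖ * (1 - t) ≤ v.re := by
      have : ‖v‖ * t = β * ‖v‖ ^ p := by rw [hpow, ht']; ring
      linarith
    have h5 : ‖v‖ ^ p * (1 - t) ≤ v.re ^ p := by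
      have ht0 : 0 ≤ t := by positivity
      calc ‖v‖ ^ p * (1 - t) ≤ ‖v‖ ^ p * (1 - t) ^ p := by
            gcongr
            exact Real.self_le_rpow_of_le_one (by linarith) (by linarith) hp1.le
        _ = (‖v‖ * (1 - t)) ^ p := (Real.mul_rpow hv0.le (by linarith)).symm
        _ ≤ v.re ^ p := by gcongr
    have h6 : 0 < ‖v‖ ^ p := by positivity
    nlinarith [mul_le_mul_of_nonneg_left h5 hα, mul_le_mul_of_nonneg_left ht h6.le]

/-- if `G` is normal with spectrum on finitely many rays from the origin and
`S` is `p`-subordinate to `G` with bound `b`, then for every `α > b` the spectrum of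
`T = G + S` is contained in a disc together with the parabolic regions around the rays;
moreover `T` has compact resolvent whenever `G` does. -/
theorem statement10 {H : Type*} [NormedAddCommGroup H] [InnerProductSpace ℂ H]
    [CompleteSpace H] (G S T : Op H)
    (hG : G.IsNormalOp)
    (n : ℕ) (θ : Fin n → ℝ) (hθ : ∀ j, 0 ≤ θ j ∧ θ j < 2 * Real.pi)
    (hspec : G.spec ⊆ ⋃ j, rayFrom (θ j))
    (p b : ℝ) (hp0 : 0 ≤ p) (hp1 : p < 1) (hb : 0 ≤ b)
    (hsub : S.Subordinate G p b)
    (hT : T = G.addOp S) :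
    (∀ α : ℝ, b < α → ∃ r0 : ℝ, 0 < r0 ∧
      T.spec ⊆ Metric.ball (0 : ℂ) r0 ∪ ⋃ j, parabRegion (θ j) α p) ∧
    (G.HasCompactResolvent → T.HasCompactResolvent) := by
  subst hT
  have hlim : Tendsto (fun r : ℝ => r ^ (p - 1)) atTop (nhds 0) := by
    simpa using tendsto_rpow_neg_atTop (y := 1 - p) (by linarith)
  refine ⟨fun α hα => ?_, ?_⟩
  · obtain ⟨β, hbβ, hβα⟩ := exists_between hα
    have hβ0 : 0 < β := hb.trans_lt hbβ
    have hlim1 : Tendsto (fun r : ℝ => β * r ^ (p - 1)) atTop (nhds 0) := by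
      simpa using hlim.const_mul β
    have e1 : ∀ᶠ r : ℝ in atTop, β * r ^ (p - 1) < 1 := hlim1.eventually_lt_const one_pos
    have e2 : ∀ᶠ r : ℝ in atTop, β < α * (1 - β * r ^ (p - 1)) := by
      have : Tendsto (fun r : ℝ => α * (1 - β * r ^ (p - 1))) atTop (nhds α) := by
        simpa using (hlim1.const_sub 1).const_mul α
      exact this.eventually_const_lt hβα
    have e3 : ∀ᶠ r : ℝ in atTop, b * (1 + β * r ^ (p - 1)) < β := by
      have : Tendsto (fun r : ℝ => b * (1 + β * r ^ (p - 1))) atTop (nhds b) := by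
        simpa using (hlim1.const_add 1).const_mul b
      exact this.eventually_lt_const hbβ
    obtain ⟨r, hr⟩ := eventually_atTop.1 (e1.and (e2.and e3))
    refine ⟨max r 1, by positivity, fun z hz => ?_⟩
    by_contra hcon
    rw [Set.mem_union, not_or, Metric.mem_ball, dist_zero_right, not_lt, max_le_iff,
      Set.mem_iUnion, not_exists] at hcon
    obtain ⟨⟨hzr, hz1⟩, hreg⟩ := hcon
    obtain ⟨h1, h2, h3⟩ := hr _ hzr
    have hz0 : 0 < ‖z‖ := by linarith
    have hpow : ‖z‖ ^ p = ‖z‖ * ‖z‖ ^ (p - 1) := by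
      rw [Real.rpow_sub_one hz0.ne']; field_simp
    have hzp : 0 < ‖z‖ ^ p := by positivity
    obtain ⟨R, U, -, hRU⟩ := hsub.exists_isResolventAt hG hp0 hp1 hb (z := z)
      (d := β * ‖z‖ ^ p) (by positivity)
      (fun w hw => by
        obtain ⟨j, hj⟩ := Set.mem_iUnion.1 (hspec hw)
        exact le_norm_sub_of_notMem_parabRegion hp0 hp1 hβ0.le (by linarith)
          (norm_pos_iff.1 hz0) (hreg j) h1.le h2.le hj)
      (by
        set t := β * ‖z‖ ^ (p - 1) with ht
        have ht0 : 0 ≤ t := by positivity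
        have h4 : ‖z‖ + β * ‖z‖ ^ p = ‖z‖ * (1 + t) := by rw [hpow, ht]; ring
        have h5 : (1 + t) ^ p ≤ 1 + t := Real.rpow_le_self_of_one_le (by linarith) hp1.le
        rw [h4, Real.mul_rpow hz0.le (by linarith)]
        calc b * (‖z‖ ^ p * (1 + t) ^ p) ≤ b * (‖z‖ ^ p * (1 + t)) := by gcongr
          _ = b * (1 + t) * ‖z‖ ^ p := by ring
          _ < β * ‖z‖ ^ p := by gcongr)
    exact hz ⟨_, hRU⟩
  · rintro ⟨z₀, R₀, hR₀, hc⟩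
    obtain ⟨w, hw⟩ := exists_notMem_iUnion_rayFrom θ
    obtain ⟨δ, hδ, hball⟩ := Metric.isOpen_iff.1
      (isClosed_iUnion_of_finite fun j => isClosed_rayFrom (θ j)).isOpen_compl w hw
    have e1 : ∀ᶠ r : ℝ in atTop, b * (‖w‖ + δ) ^ p * r ^ (p - 1) < δ := by
      have : Tendsto (fun r : ℝ => b * (‖w‖ + δ) ^ p * r ^ (p - 1)) atTop (nhds 0) := by
        simpa using hlim.const_mul (b * (‖w‖ + δ) ^ p)
      exact this.eventually_lt_const hδ
    obtain ⟨r, hr, hr0⟩ := (e1.and (eventually_gt_atTop 0)).exists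
    have hrC : (r : ℂ) ≠ 0 := by exact_mod_cast hr0.ne'
    have hnr : ‖(r : ℂ)‖ = r := by rw [Complex.norm_real, Real.norm_of_nonneg hr0.le]
    obtain ⟨R, U, hR, hRU⟩ := hsub.exists_isResolventAt hG hp0 hp1 hb (z := r * w)
      (d := r * δ) (by positivity)
      (fun v hv => by
        obtain ⟨j, hj⟩ := Set.mem_iUnion.1 (hspec hv)
        have h1 : ((r⁻¹ : ℝ) : ℂ) * v ∈ ⋃ j, rayFrom (θ j) :=
          Set.mem_iUnion.2 ⟨j, smul_mem_rayFrom (inv_nonneg.2 hr0.le) hj⟩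
        have h2 : δ ≤ ‖((r⁻¹ : ℝ) : ℂ) * v - w‖ := by
          by_contra! h
          exact hball (mem_ball_iff_norm.2 h) h1
        have h3 : v - r * w = r * (((r⁻¹ : ℝ) : ℂ) * v - w) := by
          push_cast
          field_simp
        rw [h3, norm_mul, hnr]
        gcongr)
      (by
        have hpow : r ^ p = r * r ^ (p - 1) := by
          rw [Real.rpow_sub_one hr0.ne']; field_simp
        rw [norm_mul, hnr, ← mul_add, Real.mul_rpow hr0.le (by positivity), hpow]
        calc b * (r * r ^ (p - 1) * (‖w‖ + δ) ^ p)
            = r * (b * (‖w‖ + δ) ^ p * r ^ (p - 1)) := by ring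
          _ < r * δ := by gcongr)
    exact ⟨_, _, hRU, (hR₀.isCompactOperator hR hc).comp_clm U⟩
end
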